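/- For Lebesgue-almost every irrational x ∈ (0,1), with P_n/Q_n the negative continued fraction convergents of x, one has liminf_{n→∞} (log n / n) · log Q_n(x) = 0 and limsup_{n→∞} (log n / n) · log |x − P_n(x)/Q_n(x)| = 0. -/

import Mathlib

open MeasureTheory Filter Real

/-- The negative continued fraction map `T(y) = -1/y - ⌊-1/y⌋` (with `T 0 = 0`). -/
noncomputable def negT (y : ℝ) : ℝ := Int.fract (-1 / y)

/-- The `n`-th negative continued fraction digit `a'_n(x) = ⌈1 / T^{n-1}(1-x)⌉`. -/
noncomputable def negDigit (x : ℝ) (n : ℕ) : ℕ := (⌈1 / negT^[n - 1] (1 - x)⌉).toNat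

/-- Numerators of negative continued fraction convergents, shifted so that
`negP x (n+1) = P_n` with `P_{-1} = negP x 0 = 1`, `P_0 = negP x 1 = 1`,
`P_n = a'_n P_{n-1} - P_{n-2}`. -/
noncomputable def negP (x : ℝ) : ℕ → ℤ
  | 0 => 1
  | 1 => 1
  | n + 2 => negDigit x (n + 1) * negP x (n + 1) - negP x n

/-- Denominators of negative continued fraction convergents, shifted so that
`negQ x (n+1) = Q_n` with `Q_{-1} = negQ x 0 = 0`, `Q_0 = negQ x 1 = 1`,
`Q_n = a'_n Q_{n-1} - Q_{n-2}`. -/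
noncomputable def negQ (x : ℝ) : ℕ → ℤ
  | 0 => 0
  | 1 => 1
  | n + 2 => negDigit x (n + 1) * negQ x (n + 1) - negQ x n

open scoped ENNReal

/-- The Gauss map. -/
noncomputable def gaussMap (x : ℝ) : ℝ := Int.fract x⁻¹

/-- The first regular continued fraction digit. -/
noncomputable def gaussDigit (x : ℝ) : ℕ := ⌊x⁻¹⌋₊

/-- The density on `(0,1)` of a Gauss iterate conditioned on a cylinder. -/
noncomputable def cylDensity (c x : ℝ) : ℝ≥0∞ := ENNReal.ofReal ((1 + c) / (1 + c * x) ^ 2)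

/-- The mass that `cylDensity c` gives to the points with first digit `m + 1`. -/
noncomputable def digitWeight (c : ℝ) (m : ℕ) : ℝ≥0∞ :=
  ENNReal.ofReal ((1 + c) / ((m + 1 + c) * (m + 2 + c)))

lemma measurable_gaussMap : Measurable gaussMap := by
  unfold gaussMap; fun_prop

lemma measurable_gaussDigit : Measurable gaussDigit := by
  unfold gaussDigit; fun_prop

lemma measurable_cylDensity (c : ℝ) : Measurable (cylDensity c) := by
  unfold cylDensity; fun_prop

lemma Ioo_subset_iUnion_image :
    Set.Ioo (0 : ℝ) 1 ⊆ ⋃ m : ℕ, (fun s : ℝ => ((m : ℝ) + 1 + s)⁻¹) '' Set.Ico 0 1 := by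
  intro x hx
  have h1 : 1 < x⁻¹ := (one_lt_inv₀ hx.1).2 hx.2
  have h2 : 1 ≤ ⌊x⁻¹⌋₊ := Nat.le_floor (by exact_mod_cast h1.le)
  have h3 := Nat.floor_le (zero_le_one.trans h1.le)
  have h4 := Nat.lt_floor_add_one x⁻¹
  refine Set.mem_iUnion.2 ⟨⌊x⁻¹⌋₊ - 1, x⁻¹ - ⌊x⁻¹⌋₊, ⟨by linarith, by linarith⟩, ?_⟩
  simp [Nat.cast_sub h2]

lemma gaussDigit_inv_add (m : ℕ) {s : ℝ} (hs : s ∈ Set.Ico (0 : ℝ) 1) :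
    gaussDigit ((m : ℝ) + 1 + s)⁻¹ = m + 1 := by
  unfold gaussDigit
  rw [inv_inv, Nat.floor_eq_iff (by have := hs.1; positivity)]
  push_cast
  exact ⟨by linarith [hs.1], by linarith [hs.2]⟩

lemma gaussMap_inv_add (m : ℕ) {s : ℝ} (hs : s ∈ Set.Ico (0 : ℝ) 1) :
    gaussMap ((m : ℝ) + 1 + s)⁻¹ = s := by
  unfold gaussMap
  rw [inv_inv, Int.fract_eq_iff]
  exact ⟨hs.1, hs.2, m + 1, by push_cast; ring⟩

lemma deriv_mul_cylDensity {c : ℝ} (hc : 0 ≤ c) (m : ℕ) {s : ℝ} (hs : 0 ≤ s) :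
    ENNReal.ofReal |-1 / ((m : ℝ) + 1 + s) ^ 2| * cylDensity c ((m : ℝ) + 1 + s)⁻¹ =
      digitWeight c m * cylDensity (m + 1 + c)⁻¹ s := by
  unfold cylDensity digitWeight
  rw [← ENNReal.ofReal_mul (abs_nonneg _), ← ENNReal.ofReal_mul (by positivity)]
  congr 1
  rw [abs_div, abs_neg, abs_one, abs_of_pos (by positivity)]
  have h1 : (m : ℝ) + 1 + s ≠ 0 := by positivity
  have h2 : (m : ℝ) + 1 + c ≠ 0 := by positivity
  have h3 : (m : ℝ) + 2 + c ≠ 0 := by positivity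
  have h4 : (m : ℝ) + 1 + c + s ≠ 0 := by positivity
  have e1 : 1 + c * ((m : ℝ) + 1 + s)⁻¹ = (m + 1 + c + s) / (m + 1 + s) := by
    field_simp; ring
  have e2 : 1 + ((m : ℝ) + 1 + c)⁻¹ * s = (m + 1 + c + s) / (m + 1 + c) := by
    field_simp
  have e3 : 1 + ((m : ℝ) + 1 + c)⁻¹ = (m + 2 + c) / (m + 1 + c) := by
    field_simp; ring
  rw [e1, e2, e3]
  field_simp

lemma setLIntegral_gauss_branch {c : ℝ} (hc : 0 ≤ c) (m : ℕ) (h : ℕ → ℝ≥0∞)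
    {g : ℝ → ℝ≥0∞} (hg : Measurable g) :
    ∫⁻ x in (fun s : ℝ => ((m : ℝ) + 1 + s)⁻¹) '' Set.Ico 0 1,
        h (gaussDigit x) * g (gaussMap x) * cylDensity c x =
      h (m + 1) * digitWeight c m *
        ∫⁻ s in Set.Ico (0 : ℝ) 1, g s * cylDensity (m + 1 + c)⁻¹ s := by
  rw [lintegral_image_eq_lintegral_abs_deriv_mul (f' := fun s => -1 / ((m : ℝ) + 1 + s) ^ 2)
    measurableSet_Ico]
  · rw [← lintegral_const_mul _ (hg.fun_mul (measurable_cylDensity _))]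
    refine setLIntegral_congr_fun measurableSet_Ico fun s hs => ?_
    rw [gaussDigit_inv_add m hs, gaussMap_inv_add m hs]
    have := deriv_mul_cylDensity hc m hs.1
    calc _ = h (m + 1) * g s * (ENNReal.ofReal |-1 / ((m : ℝ) + 1 + s) ^ 2| *
          cylDensity c ((m : ℝ) + 1 + s)⁻¹) := by ring
      _ = _ := by rw [this]; ring
  · intro s hs
    have hs0 := hs.1
    refine HasDerivAt.hasDerivWithinAt ?_
    exact ((hasDerivAt_id s).const_add ((m : ℝ) + 1)).fun_inv (by simp only [id]; positivity)
  · intro s _ t _ hst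
    simpa using hst

lemma setLIntegral_gauss_le {c : ℝ} (hc : 0 ≤ c) {h : ℕ → ℝ≥0∞} {g : ℝ → ℝ≥0∞}
    (hg : Measurable g) {B D : ℝ≥0∞} (hB : ∑' m, h (m + 1) * digitWeight c m ≤ B)
    (hD : ∀ c' ∈ Set.Icc (0 : ℝ) 1, ∫⁻ x in Set.Ioo (0 : ℝ) 1, g x * cylDensity c' x ≤ D) :
    ∫⁻ x in Set.Ioo (0 : ℝ) 1, h (gaussDigit x) * g (gaussMap x) * cylDensity c x ≤ B * D := by
  calc _ ≤ ∫⁻ x in ⋃ m : ℕ, (fun s : ℝ => ((m : ℝ) + 1 + s)⁻¹) '' Set.Ico 0 1,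
        h (gaussDigit x) * g (gaussMap x) * cylDensity c x :=
        lintegral_mono_set Ioo_subset_iUnion_image
    _ ≤ ∑' m : ℕ, ∫⁻ x in (fun s : ℝ => ((m : ℝ) + 1 + s)⁻¹) '' Set.Ico 0 1,
        h (gaussDigit x) * g (gaussMap x) * cylDensity c x := lintegral_iUnion_le _ _
    _ ≤ ∑' m : ℕ, h (m + 1) * digitWeight c m * D := by
        refine ENNReal.tsum_le_tsum fun m => ?_
        rw [setLIntegral_gauss_branch hc m h hg]
        gcongr
        rw [← setLIntegral_congr Ioo_ae_eq_Ico]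
        refine hD _ ⟨by positivity, inv_le_one_of_one_le₀ ?_⟩
        have : (0 : ℝ) ≤ m := m.cast_nonneg
        linarith
    _ ≤ B * D := by
        rw [ENNReal.tsum_mul_right]
        gcongr

lemma measurable_prod_gauss (h : ℕ → ℕ → ℝ≥0∞) (k : ℕ) :
    Measurable fun x => ∏ i ∈ Finset.range k, h i (gaussDigit (gaussMap^[i] x)) :=
  Finset.measurable_fun_prod _ fun i _ => (measurable_from_top (f := h i)).comp
    (measurable_gaussDigit.comp (measurable_gaussMap.iterate i))

lemma setLIntegral_prod_gauss_le (k : ℕ) : ∀ {h : ℕ → ℕ → ℝ≥0∞} {B : ℕ → ℝ≥0∞},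
    (∀ i, ∀ c ∈ Set.Icc (0 : ℝ) 1, ∑' m, h i (m + 1) * digitWeight c m ≤ B i) →
    ∀ c ∈ Set.Icc (0 : ℝ) 1,
      ∫⁻ x in Set.Ioo (0 : ℝ) 1,
        (∏ i ∈ Finset.range k, h i (gaussDigit (gaussMap^[i] x))) * cylDensity c x ≤
      (∏ i ∈ Finset.range k, B i) * 2 := by
  induction k with
  | zero =>
    intro h B _ c hc
    simp only [Finset.range_zero, Finset.prod_empty, one_mul]
    calc _ ≤ ∫⁻ x in Set.Ioo (0 : ℝ) 1, (2 : ℝ≥0∞) := by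
          refine setLIntegral_mono measurable_const fun x hx => ?_
          have h0 : 0 ≤ c * x := mul_nonneg hc.1 hx.1.le
          unfold cylDensity
          refine ENNReal.ofReal_le_of_le_toReal ?_
          rw [ENNReal.toReal_ofNat, div_le_iff₀ (by positivity)]
          nlinarith [hc.2, sq_nonneg (c * x)]
      _ = 2 := by simp
  | succ k ih =>
    intro h B hB c hc
    have key := setLIntegral_gauss_le hc.1 (measurable_prod_gauss (fun i => h (i + 1)) k)
      (hB 0 c hc) (ih fun i => hB (i + 1))
    refine (le_of_eq ?_).trans (key.trans (le_of_eq ?_))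
    · refine lintegral_congr fun x => ?_
      rw [Finset.prod_range_succ']
      simp only [Function.iterate_succ, Function.comp_apply, Function.iterate_zero, id]
      ring
    · rw [Finset.prod_range_succ']; ring

/-- Products of functions of the digits integrate at most like independent variables, up to
the factor `2`. -/
lemma setLIntegral_prod_gauss_le' (k : ℕ) {h : ℕ → ℕ → ℝ≥0∞} {B : ℕ → ℝ≥0∞}
    (hB : ∀ i, ∀ c ∈ Set.Icc (0 : ℝ) 1, ∑' m, h i (m + 1) * digitWeight c m ≤ B i) :
    ∫⁻ x in Set.Ioo (0 : ℝ) 1, ∏ i ∈ Finset.range k, h i (gaussDigit (gaussMap^[i] x)) ≤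
      (∏ i ∈ Finset.range k, B i) * 2 := by
  simpa [cylDensity] using setLIntegral_prod_gauss_le k hB 0 (by simp)

lemma sum_digitWeight {c : ℝ} (hc : 0 ≤ c) (N : ℕ) :
    ∑ m ∈ Finset.range N, digitWeight c m = ENNReal.ofReal (1 - (1 + c) / (N + 1 + c)) := by
  unfold digitWeight
  rw [← ENNReal.ofReal_sum_of_nonneg fun m _ => by positivity]
  congr 1
  induction N with
  | zero => have : (1 + c) ≠ 0 := by positivity
            simp [this]
  | succ n ih =>
    rw [Finset.sum_range_succ, ih]
    push_cast
    have h2 : (n : ℝ) + 1 + c ≠ 0 := by positivity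
    have h3 : (n : ℝ) + 2 + c ≠ 0 := by positivity
    have h4 : (n : ℝ) + 1 + 1 + c ≠ 0 := by positivity
    field_simp
    ring

lemma tsum_digitWeight_le {c : ℝ} (hc : 0 ≤ c) : ∑' m, digitWeight c m ≤ 1 := by
  refine ENNReal.tsum_le_of_sum_range_le fun N => ?_
  rw [sum_digitWeight hc, ENNReal.ofReal_le_one]
  have : 0 ≤ (1 + c) / (N + 1 + c) := by positivity
  linarith

lemma tsum_indicator_digitWeight_le {c : ℝ} (hc : c ∈ Set.Icc (0 : ℝ) 1) {M : ℕ} (hM : 0 < M) :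
    ∑' m, (if m + 1 < M then 1 else 0) * digitWeight c m ≤ ENNReal.ofReal (exp (-(1 / M))) := by
  rw [tsum_eq_sum (s := Finset.range (M - 1))]
  · calc _ = ∑ m ∈ Finset.range (M - 1), digitWeight c m := by
          refine Finset.sum_congr rfl fun m hm => ?_
          rw [Finset.mem_range] at hm
          rw [if_pos (by omega), one_mul]
      _ ≤ _ := by
          rw [sum_digitWeight hc.1, Nat.cast_sub hM]
          refine ENNReal.ofReal_le_ofReal ?_
          have hM' : (1 : ℝ) ≤ M := by exact_mod_cast hM
          have h0 := hc.1
          have h1 : 1 / (M : ℝ) ≤ (1 + c) / (((M : ℝ) - (1 : ℕ)) + 1 + c) := by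
            push_cast
            rw [div_le_div_iff₀ (by positivity) (by linarith)]
            nlinarith
          linarith [add_one_le_exp (-(1 / (M : ℝ)))]
  · intro m hm
    rw [Finset.mem_range] at hm
    rw [if_neg (by omega), zero_mul]

lemma exists_tsum_sqrt_digitWeight_le : ∃ B : ℝ, 0 < B ∧ ∀ c ∈ Set.Icc (0 : ℝ) 1,
    ∑' m : ℕ, ENNReal.ofReal (√((m + 1 : ℕ) + 1 : ℝ)) * digitWeight c m ≤ ENNReal.ofReal B := by
  have hs : Summable fun m : ℕ => 4 * (1 / (((m + 2 : ℕ) : ℝ)) ^ (3 / 2 : ℝ)) :=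
    (((summable_nat_add_iff 2).2
      (Real.summable_one_div_nat_rpow.2 (by norm_num : (1 : ℝ) < 3 / 2)))).mul_left 4
  refine ⟨∑' m : ℕ, 4 * (1 / (((m + 2 : ℕ) : ℝ)) ^ (3 / 2 : ℝ)),
    hs.tsum_pos (fun m => by positivity) 0 (by positivity), fun c hc => ?_⟩
  rw [ENNReal.ofReal_tsum_of_nonneg (fun m => by positivity) hs]
  refine ENNReal.tsum_le_tsum fun m => ?_
  unfold digitWeight
  rw [← ENNReal.ofReal_mul (by positivity)]
  refine ENNReal.ofReal_le_ofReal ?_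
  have h0 := hc.1
  have h1 := hc.2
  have hm : (0 : ℝ) ≤ m := m.cast_nonneg
  push_cast
  have e : (m : ℝ) + 1 + 1 = m + 2 := by ring
  rw [e]
  have hp : ((m : ℝ) + 2) ^ (3 / 2 : ℝ) * √((m : ℝ) + 2) = (m + 2) ^ 2 := by
    rw [Real.sqrt_eq_rpow, ← Real.rpow_add (by positivity), ← Real.rpow_natCast]
    norm_num
  rw [mul_one_div, mul_div_assoc', div_le_div_iff₀ (by positivity) (by positivity)]
  calc √((m : ℝ) + 2) * (1 + c) * (m + 2) ^ (3 / 2 : ℝ)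
      = (1 + c) * (m + 2) ^ 2 := by rw [← hp]; ring
    _ ≤ 4 * ((m + 1 + c) * (m + 2 + c)) := by nlinarith [mul_nonneg hm h0]

/-- Almost surely the product of the first `k` digits (shifted by one) is at most exponential. -/
lemma ae_exists_prod_digit_le : ∃ L : ℝ, 0 < L ∧ ∀ᵐ x ∂(volume.restrict (Set.Ioo (0 : ℝ) 1)),
    ∀ᶠ k in atTop, ∏ i ∈ Finset.range k, ((gaussDigit (gaussMap^[i] x) : ℝ) + 1) ≤ exp (L * k) := by
  obtain ⟨B, hB0, hB⟩ := exists_tsum_sqrt_digitWeight_le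
  set R : ℝ := 2 * (B + 1) with hR
  have hR1 : 1 < R := by linarith
  refine ⟨2 * log R, by have := log_pos hR1; positivity, ?_⟩
  set h : ℕ → ℝ≥0∞ := fun a => ENNReal.ofReal (√((a : ℝ) + 1)) with hh
  set F : ℕ → ℝ → ℝ≥0∞ := fun k x => ∏ i ∈ Finset.range k, h (gaussDigit (gaussMap^[i] x)) with hF
  have hint : ∀ k, ∫⁻ x in Set.Ioo (0 : ℝ) 1, F k x ≤ ENNReal.ofReal (B ^ k * 2) := by
    intro k
    refine (setLIntegral_prod_gauss_le' k (h := fun _ => h) (B := fun _ => ENNReal.ofReal B)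
      fun _ c hc => hB c hc).trans (le_of_eq ?_)
    rw [Finset.prod_const, Finset.card_range, ENNReal.ofReal_mul (by positivity),
      ENNReal.ofReal_pow hB0.le, ENNReal.ofReal_ofNat]
  have hmeas : ∀ k, (volume.restrict (Set.Ioo (0 : ℝ) 1)) {x | ENNReal.ofReal (R ^ k) ≤ F k x} ≤
      ENNReal.ofReal (2 * (1 / 2) ^ k) := by
    intro k
    refine (meas_ge_le_lintegral_div (measurable_prod_gauss (fun _ => h) k).aemeasurable
      (by simp; positivity) (by simp)).trans ?_
    refine (ENNReal.div_le_div_right (hint k) _).trans ?_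
    rw [← ENNReal.ofReal_div_of_pos (by positivity)]
    refine ENNReal.ofReal_le_ofReal ?_
    rw [div_le_iff₀ (by positivity), mul_assoc, ← mul_pow]
    have : (1 / 2 * R) = B + 1 := by rw [hR]; ring
    rw [this, mul_comm]
    gcongr
    linarith
  have hsum : ∑' k, (volume.restrict (Set.Ioo (0 : ℝ) 1))
      {x | ENNReal.ofReal (R ^ k) ≤ F k x} ≠ ⊤ := by
    refine ne_top_of_le_ne_top ?_ (ENNReal.tsum_le_tsum hmeas)
    rw [← ENNReal.ofReal_tsum_of_nonneg (fun k => by positivity)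
      ((summable_geometric_of_lt_one (by norm_num) (by norm_num)).mul_left 2)]
    exact ENNReal.ofReal_ne_top
  filter_upwards [ae_eventually_notMem hsum] with x hx
  filter_upwards [hx] with k hk
  simp only [not_le, hF, hh] at hk
  rw [← ENNReal.ofReal_prod_of_nonneg (fun i _ => by positivity),
    ENNReal.ofReal_lt_ofReal_iff (by positivity)] at hk
  have hsq : ∏ i ∈ Finset.range k, ((gaussDigit (gaussMap^[i] x) : ℝ) + 1) =
      (∏ i ∈ Finset.range k, √((gaussDigit (gaussMap^[i] x) : ℝ) + 1)) ^ 2 := by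
    rw [← Finset.prod_pow]
    exact Finset.prod_congr rfl fun i _ => (Real.sq_sqrt (by positivity)).symm
  have hexp : exp (2 * log R * k) = (R ^ k) ^ 2 := by
    rw [← pow_mul, mul_comm k 2, ← Real.rpow_natCast, Real.rpow_def_of_pos (by linarith)]
    congr 1; push_cast; ring
  rw [hsq, hexp]
  have : 0 ≤ ∏ i ∈ Finset.range k, √((gaussDigit (gaussMap^[i] x) : ℝ) + 1) :=
    Finset.prod_nonneg fun i _ => by positivity
  gcongr

/-- Borel–Bernstein along even indices: divergence half. -/
lemma ae_exists_digit_ge {M : ℕ → ℕ} (hM : ∀ j, 0 < M j)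
    (hdiv : ¬ Summable fun j => 1 / (M j : ℝ)) (k₀ : ℕ) :
    ∀ᵐ x ∂(volume.restrict (Set.Ioo (0 : ℝ) 1)),
      ∃ j, k₀ ≤ j ∧ M j ≤ gaussDigit (gaussMap^[2 * j] x) := by
  set μ := volume.restrict (Set.Ioo (0 : ℝ) 1)
  set δ : ℕ → ℝ := fun i => if Even i ∧ k₀ ≤ i / 2 then 1 / (M (i / 2) : ℝ) else 0 with hδ
  have hδ0 : ∀ i, 0 ≤ δ i := fun i => by simp only [hδ]; split_ifs <;> positivity
  have hδdiv : ¬ Summable δ := fun hs => hdiv <| (summable_nat_add_iff k₀).1 <| by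
    have := hs.comp_injective (i := fun j : ℕ => 2 * (j + k₀)) fun a b h => by simpa using h
    refine this.congr fun j => ?_
    simp [hδ]
  set h : ℕ → ℕ → ℝ≥0∞ := fun i a =>
    if Even i ∧ k₀ ≤ i / 2 then (if a < M (i / 2) then 1 else 0) else 1 with hh
  have hB : ∀ i, ∀ c ∈ Set.Icc (0 : ℝ) 1,
      ∑' m, h i (m + 1) * digitWeight c m ≤ ENNReal.ofReal (exp (-δ i)) := by
    intro i c hc
    by_cases hi : Even i ∧ k₀ ≤ i / 2
    · simp only [hh, hδ, if_pos hi]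
      exact tsum_indicator_digitWeight_le hc (hM _)
    · simp only [hh, hδ, if_neg hi]
      simpa using tsum_digitWeight_le hc.1
  have hbound : ∀ k, μ {x | ¬ ∃ j, k₀ ≤ j ∧ M j ≤ gaussDigit (gaussMap^[2 * j] x)} ≤
      ENNReal.ofReal (exp (-∑ i ∈ Finset.range k, δ i)) * 2 := by
    intro k
    rw [← Finset.sum_neg_distrib, Real.exp_sum,
      ENNReal.ofReal_prod_of_nonneg fun i _ => (exp_pos _).le]
    refine le_trans ?_ (setLIntegral_prod_gauss_le' k hB)
    refine le_trans ?_ (mul_meas_ge_le_lintegral (measurable_prod_gauss h k) 1)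
    rw [one_mul]
    refine measure_mono fun x hx => ?_
    simp only [Set.mem_ofPred_eq, not_exists, not_and, not_le] at hx ⊢
    refine (Finset.prod_eq_one fun i _ => ?_).ge
    simp only [hh]
    split_ifs with hi hlt
    · rfl
    · refine absurd ?_ hlt
      have := hx (i / 2) hi.2
      rwa [Nat.two_mul_div_two_of_even hi.1] at this
    · rfl
  have hlim : Tendsto (fun k => ENNReal.ofReal (exp (-∑ i ∈ Finset.range k, δ i)) * 2) atTop
      (nhds 0) := by
    have h1 : Tendsto (fun k => ∑ i ∈ Finset.range k, δ i) atTop atTop :=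
      (not_summable_iff_tendsto_nat_atTop_of_nonneg hδ0).1 hδdiv
    have h2 : Tendsto (fun k => exp (-∑ i ∈ Finset.range k, δ i)) atTop (nhds 0) :=
      Real.tendsto_exp_neg_atTop_nhds_zero.comp h1
    have h3 := ENNReal.Tendsto.mul_const (b := 2) (ENNReal.tendsto_ofReal h2) (Or.inr (by simp))
    simpa using h3
  rw [ae_iff]
  exact le_antisymm (ge_of_tendsto' hlim hbound) zero_le

lemma not_summable_one_div_mul_log : ¬ Summable fun n : ℕ => 1 / ((n : ℝ) * (1 + log n)) := by
  rw [← summable_condensed_iff_of_nonneg]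
  · intro hs
    refine Real.not_summable_one_div_natCast ((summable_nat_add_iff 1).1 ?_)
    refine hs.of_nonneg_of_le (fun k => by positivity) fun k => ?_
    have hlog : log ((2 : ℕ) ^ k : ℕ) = k * log 2 := by push_cast; rw [Real.log_pow]
    rw [hlog]
    have h2 : log 2 ≤ 1 := by linarith [Real.log_two_lt_d9]
    have h3 : 0 ≤ log 2 := Real.log_nonneg (by norm_num)
    push_cast
    rw [mul_one_div, div_mul_eq_div_div, div_self (by positivity)]
    refine one_div_le_one_div_of_le (by positivity) ?_
    have hk : (0 : ℝ) ≤ k := k.cast_nonneg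
    nlinarith
  · intro n
    have := Real.log_natCast_nonneg n
    positivity
  · intro m n hm hmn
    have h1 := Real.log_natCast_nonneg m
    have hm' : (0 : ℝ) < m := by exact_mod_cast hm
    have h2 : (m : ℝ) ≤ n := by exact_mod_cast hmn
    have h3 := Real.log_le_log hm' h2
    refine one_div_le_one_div_of_le (by positivity) ?_
    gcongr

lemma ae_frequently_digit_ge : ∀ᵐ x ∂(volume.restrict (Set.Ioo (0 : ℝ) 1)), ∀ C k₀ : ℕ,
    ∃ k, k₀ ≤ k ∧ (C : ℝ) * (k * (1 + log k)) + 2 ≤ gaussDigit (gaussMap^[2 * k] x) := by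
  rw [ae_all_iff]; intro C
  rw [ae_all_iff]; intro k₀
  set M : ℕ → ℕ := fun j => ⌈(C : ℝ) * (j * (1 + log j)) + 2⌉₊ with hMdef
  have hpos : ∀ j : ℕ, 0 ≤ (C : ℝ) * (j * (1 + log j)) := fun j => by
    have := Real.log_natCast_nonneg j
    positivity
  have hM : ∀ j, 0 < M j := fun j => Nat.ceil_pos.2 (by linarith [hpos j])
  have hdiv : ¬ Summable fun j => 1 / (M j : ℝ) := by
    intro hs
    refine not_summable_one_div_mul_log ((summable_nat_add_iff 1).1 ?_)
    refine Summable.of_nonneg_of_le (fun j => ?_) (fun j => ?_)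
      (((summable_nat_add_iff 1).2 hs).mul_left ((C : ℝ) + 3))
    · have := Real.log_natCast_nonneg (j + 1)
      positivity
    · have h1 := Real.log_natCast_nonneg (j + 1)
      have h2 := (Nat.ceil_lt_add_one (by linarith [hpos (j + 1)] :
        0 ≤ (C : ℝ) * ((j + 1 : ℕ) * (1 + log (j + 1 : ℕ))) + 2)).le
      have h3 : (1 : ℝ) ≤ (j + 1 : ℕ) := by simp
      have h4 : (0 : ℝ) < M (j + 1) := by exact_mod_cast hM (j + 1)
      rw [mul_one_div, div_le_div_iff₀ (by positivity) h4, one_mul]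
      refine h2.trans ?_
      nlinarith [mul_nonneg (by linarith : (0 : ℝ) ≤ (j + 1 : ℕ)) h1]
  filter_upwards [ae_exists_digit_ge hM hdiv k₀] with x hx
  obtain ⟨k, hk, hx⟩ := hx
  exact ⟨k, hk, (Nat.le_ceil _).trans (by exact_mod_cast hx)⟩

lemma gaussMap_mem {s : ℝ} (hs : Irrational s) :
    Irrational (gaussMap s) ∧ gaussMap s ∈ Set.Ioo (0 : ℝ) 1 := by
  have h : Irrational (gaussMap s) := hs.inv.sub_intCast ⌊s⁻¹⌋
  exact ⟨h, (Int.fract_nonneg _).lt_of_ne h.ne_zero.symm, Int.fract_lt_one _⟩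

lemma gaussMap_iterate_mem {s : ℝ} (hs : Irrational s) (hs' : s ∈ Set.Ioo (0 : ℝ) 1) (n : ℕ) :
    Irrational (gaussMap^[n] s) ∧ gaussMap^[n] s ∈ Set.Ioo (0 : ℝ) 1 := by
  induction n with
  | zero => exact ⟨hs, hs'⟩
  | succ n ih => rw [Function.iterate_succ_apply']; exact gaussMap_mem ih.1

lemma inv_eq_gaussDigit_add {s : ℝ} (hs : 0 < s) : s⁻¹ = gaussDigit s + gaussMap s := by
  unfold gaussDigit gaussMap
  rw [natCast_floor_eq_intCast_floor (by positivity), Int.floor_add_fract]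

lemma one_le_gaussDigit {s : ℝ} (hs : s ∈ Set.Ioo (0 : ℝ) 1) : 1 ≤ gaussDigit s :=
  Nat.le_floor (by exact_mod_cast ((one_lt_inv₀ hs.1).2 hs.2).le)

/-- Reading off one digit of the negative continued fraction. -/
lemma negCF_step {x w : ℝ} {n d : ℕ} (h : 1 / negT^[n] (1 - x) = d - w)
    (hw : w ∈ Set.Ico (0 : ℝ) 1) : negDigit x (n + 1) = d ∧ negT^[n + 1] (1 - x) = w := by
  constructor
  · unfold negDigit
    have : ⌈(d : ℝ) - w⌉ = (d : ℤ) := by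
      rw [Int.ceil_eq_iff]; push_cast; constructor <;> linarith [hw.1, hw.2]
    rw [Nat.add_sub_cancel, h, this, Int.toNat_natCast]
  · rw [Function.iterate_succ_apply', negT, neg_div, h, Int.fract_eq_iff]
    exact ⟨hw.1, hw.2, -d, by push_cast; ring⟩

lemma negT_iterate_mem {x : ℝ} (hx : Irrational x) (hx' : x ∈ Set.Ioo (0 : ℝ) 1)
    (n : ℕ) :
    Irrational (negT^[n] (1 - x)) ∧ negT^[n] (1 - x) ∈ Set.Ioo (0 : ℝ) 1 := by
  induction n with
  | zero =>
    refine ⟨by simpa using hx.natCast_sub 1, ?_⟩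
    simp only [Function.iterate_zero, id]
    exact ⟨by linarith [hx'.2], by linarith [hx'.1]⟩
  | succ n ih =>
    rw [Function.iterate_succ_apply']
    set z := negT^[n] (1 - x)
    have h : Irrational (negT z) := by
      have := ih.1.inv.neg.sub_intCast ⌊-1 / z⌋
      rwa [← one_div, ← neg_div] at this
    exact ⟨h, (Int.fract_nonneg _).lt_of_ne h.ne_zero.symm, Int.fract_lt_one _⟩

lemma negDigit_eq {x : ℝ} (hx : Irrational x) (hx' : x ∈ Set.Ioo (0 : ℝ) 1)
    (n : ℕ) :
    (negDigit x (n + 1) : ℝ) = negT^[n + 1] (1 - x) + 1 / negT^[n] (1 - x) := by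
  obtain ⟨-, hz⟩ := negT_iterate_mem hx hx' n
  have hpos : 0 < 1 / negT^[n] (1 - x) := one_div_pos.2 hz.1
  have h0 : 0 ≤ ⌈1 / negT^[n] (1 - x)⌉ := Int.ceil_nonneg hpos.le
  have h1 : ((⌈1 / negT^[n] (1 - x)⌉.toNat : ℕ) : ℝ) = (⌈1 / negT^[n] (1 - x)⌉ : ℝ) := by
    exact_mod_cast congrArg (Int.cast (R := ℝ)) (Int.toNat_of_nonneg h0)
  rw [Function.iterate_succ_apply', negDigit, Nat.add_sub_cancel, h1, negT, neg_div, Int.fract,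
    Int.floor_neg]
  push_cast
  ring

lemma two_le_negDigit {x : ℝ} (hx : Irrational x) (hx' : x ∈ Set.Ioo (0 : ℝ) 1)
    (n : ℕ) : 2 ≤ negDigit x (n + 1) := by
  obtain ⟨-, hz⟩ := negT_iterate_mem hx hx' n
  obtain ⟨-, hz'⟩ := negT_iterate_mem hx hx' (n + 1)
  have h := negDigit_eq hx hx' n
  have h1 : 1 < 1 / negT^[n] (1 - x) := by rw [lt_div_iff₀ hz.1]; linarith [hz.2]
  have : (1 : ℝ) < negDigit x (n + 1) := by linarith [hz'.1]
  exact_mod_cast this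

lemma negQ_increment {x : ℝ} (hx : Irrational x) (hx' : x ∈ Set.Ioo (0 : ℝ) 1)
    (n : ℕ) : 0 ≤ negQ x n ∧ 1 ≤ negQ x (n + 1) - negQ x n := by
  induction n with
  | zero => simp [negQ]
  | succ n ih =>
    refine ⟨by linarith, ?_⟩
    have h : (2 : ℤ) ≤ negDigit x (n + 1) := by exact_mod_cast two_le_negDigit hx hx' n
    rw [negQ]
    nlinarith

lemma negCF_formula {x : ℝ} (hx : Irrational x) (hx' : x ∈ Set.Ioo (0 : ℝ) 1)
    (n : ℕ) :
    x * (negQ x (n + 1) - negQ x n * negT^[n] (1 - x)) =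
      negP x (n + 1) - negP x n * negT^[n] (1 - x) := by
  induction n with
  | zero => simp [negQ, negP]
  | succ n ih =>
    have hz := (negT_iterate_mem hx hx' n).2.1
    have hd := negDigit_eq hx hx' n
    rw [negQ, negP]
    push_cast
    rw [hd]
    refine mul_left_cancel₀ hz.ne' ?_
    have e : negT^[n] (1 - x) * (1 / negT^[n] (1 - x)) = 1 := mul_one_div_cancel hz.ne'
    linear_combination ih + (x * negQ x (n + 1) - negP x (n + 1)) * e

lemma negCF_det (x : ℝ) (n : ℕ) :
    negP x (n + 1) * negQ x n - negP x n * negQ x (n + 1) = -1 := by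
  induction n with
  | zero => simp [negQ, negP]
  | succ n ih =>
    rw [negQ, negP]
    linear_combination ih

lemma abs_sub_negCF {x : ℝ} (hx : Irrational x) (hx' : x ∈ Set.Ioo (0 : ℝ) 1)
    (n : ℕ) :
    |x - (negP x (n + 1) : ℝ) / (negQ x (n + 1) : ℝ)| = negT^[n] (1 - x) /
      (negQ x (n + 1) * (negQ x (n + 1) - negQ x n * negT^[n] (1 - x))) := by
  obtain ⟨-, hz0, hz1⟩ := negT_iterate_mem hx hx' n
  obtain ⟨h0, h1⟩ := negQ_increment hx hx' n
  have h0' : (0 : ℝ) ≤ negQ x n := by exact_mod_cast h0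
  have h1' : (1 : ℝ) ≤ negQ x (n + 1) - negQ x n := by exact_mod_cast h1
  have hf := negCF_formula hx hx' n
  have hd : (negP x (n + 1) * negQ x n - negP x n * negQ x (n + 1) : ℝ) = -1 := by
    exact_mod_cast negCF_det x n
  have hQ : (0 : ℝ) < negQ x (n + 1) := by linarith
  have hQ' : (0 : ℝ) < negQ x (n + 1) - negQ x n * negT^[n] (1 - x) := by nlinarith
  have : x - (negP x (n + 1) : ℝ) / (negQ x (n + 1) : ℝ) = -(negT^[n] (1 - x) /
      (negQ x (n + 1) * (negQ x (n + 1) - negQ x n * negT^[n] (1 - x)))) := by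
    obtain ⟨D, hD⟩ : ∃ D, D = (negQ x (n + 1) : ℝ) - negQ x n * negT^[n] (1 - x) := ⟨_, rfl⟩
    rw [← hD] at hf hQ' ⊢
    field_simp
    linear_combination (negQ x (n + 1) : ℝ) * hf + negT^[n] (1 - x) * hd - negP x (n + 1) * hD
  rw [this, abs_neg, abs_of_pos (by positivity)]

lemma log_negQ_nonneg {x : ℝ} (hx : Irrational x) (hx' : x ∈ Set.Ioo (0 : ℝ) 1)
    (n : ℕ) : 0 ≤ log (negQ x (n + 1)) := by
  obtain ⟨h0, h1⟩ := negQ_increment hx hx' n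
  exact Real.log_nonneg (by exact_mod_cast (by linarith : (1 : ℤ) ≤ negQ x (n + 1)))

lemma log_abs_sub_negCF_nonpos {x : ℝ} (hx : Irrational x) (hx' : x ∈ Set.Ioo (0 : ℝ) 1)
    (n : ℕ) :
    log |x - (negP x (n + 1) : ℝ) / (negQ x (n + 1) : ℝ)| ≤ 0 := by
  refine Real.log_nonpos (abs_nonneg _) ?_
  obtain ⟨-, hz0, hz1⟩ := negT_iterate_mem hx hx' n
  obtain ⟨h0, h1⟩ := negQ_increment hx hx' n
  have h0' : (0 : ℝ) ≤ negQ x n := by exact_mod_cast h0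
  have h1' : (1 : ℝ) ≤ negQ x (n + 1) - negQ x n := by exact_mod_cast h1
  have hQ : (1 : ℝ) ≤ negQ x (n + 1) := by linarith
  have hQ' : (1 : ℝ) ≤ negQ x (n + 1) - negQ x n * negT^[n] (1 - x) := by nlinarith
  rw [abs_sub_negCF hx hx']
  exact div_le_one_of_le₀ (by nlinarith) (by positivity)

lemma neg_le_log_abs_sub_negCF {x : ℝ} (hx : Irrational x) (hx' : x ∈ Set.Ioo (0 : ℝ) 1)
    {n : ℕ} (hz : 1 / 2 ≤ negT^[n] (1 - x)) :
    -(2 * log (negQ x (n + 1)) + log 2) ≤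
      log |x - (negP x (n + 1) : ℝ) / (negQ x (n + 1) : ℝ)| := by
  obtain ⟨-, hz0, hz1⟩ := negT_iterate_mem hx hx' n
  obtain ⟨h0, h1⟩ := negQ_increment hx hx' n
  have h0' : (0 : ℝ) ≤ negQ x n := by exact_mod_cast h0
  have h1' : (1 : ℝ) ≤ negQ x (n + 1) - negQ x n := by exact_mod_cast h1
  have hQ : (0 : ℝ) < negQ x (n + 1) := by linarith
  have hQ' : (0 : ℝ) < negQ x (n + 1) - negQ x n * negT^[n] (1 - x) := by nlinarith
  have e : -(2 * log (negQ x (n + 1)) + log 2) =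
      log ((1 / 2) / ((negQ x (n + 1) : ℝ) * negQ x (n + 1))) := by
    rw [Real.log_div (by norm_num) (by positivity), Real.log_mul hQ.ne' hQ.ne', one_div,
      Real.log_inv]
    ring
  rw [e, abs_sub_negCF hx hx']
  refine Real.log_le_log (by positivity) ?_
  gcongr
  nlinarith

lemma negCF_run {x : ℝ} {N : ℕ} {s : ℝ} (hs : s ∈ Set.Ioo (0 : ℝ) 1) (hs' : Irrational s)
    (hN : negT^[N] (1 - x) = 1 - s) {j : ℕ} (hj : j + 1 ≤ gaussDigit s) :
    negT^[N + j] (1 - x) = 1 - (s⁻¹ - j)⁻¹ ∧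
    negQ x (N + j + 1) - negQ x (N + j) = negQ x (N + 1) - negQ x N ∧
    negQ x (N + j + 1) = negQ x (N + 1) + j * (negQ x (N + 1) - negQ x N) := by
  induction j with
  | zero => simp [hN]
  | succ j ih =>
    obtain ⟨h1, h2, h3⟩ := ih (by omega)
    have hG := (gaussMap_mem hs').2
    have hinv := inv_eq_gaussDigit_add hs.1
    have hj' : (j : ℝ) + 1 + 1 ≤ gaussDigit s := by exact_mod_cast hj
    have hu : 2 < s⁻¹ - j := by linarith [hG.1]
    obtain ⟨hd, hz⟩ := negCF_step (x := x) (n := N + j) (d := 2)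
      (w := 1 - (s⁻¹ - (j + 1 : ℕ))⁻¹) (by
        rw [h1]
        push_cast
        have e1 : s⁻¹ - (j + 1) ≠ 0 := by linarith
        have e2 : s⁻¹ - j ≠ 0 := by linarith
        have e3 : 1 - (s⁻¹ - j)⁻¹ = (s⁻¹ - (j + 1)) / (s⁻¹ - j) := by
          rw [eq_div_iff e2, sub_mul, inv_mul_cancel₀ e2]; ring
        rw [e3, one_div_div, div_eq_iff e1]
        linear_combination -inv_mul_cancel₀ e1) (by
        push_cast
        have : 1 < s⁻¹ - (j + 1) := by linarith
        exact ⟨by linarith [inv_le_one_of_one_le₀ this.le],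
          by linarith [inv_pos.2 (zero_lt_one.trans this)]⟩)
    have hQ : negQ x (N + (j + 1) + 1) = 2 * negQ x (N + j + 1) - negQ x (N + j) := by
      rw [show N + (j + 1) + 1 = N + j + 2 by ring, negQ, hd]; rfl
    refine ⟨hz, ?_, ?_⟩
    · rw [hQ, show N + (j + 1) = N + j + 1 by ring]; linarith
    · rw [hQ]; push_cast; linarith

lemma negCF_gauss_step {x : ℝ} (hx : Irrational x) (hx' : x ∈ Set.Ioo (0 : ℝ) 1)
    {N : ℕ} {s : ℝ} (hs : s ∈ Set.Ioo (0 : ℝ) 1) (hs' : Irrational s)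
    (hN : negT^[N] (1 - x) = 1 - s) :
    negT^[N + gaussDigit s] (1 - x) = 1 - gaussMap (gaussMap s) ∧
    (negQ x (N + gaussDigit s + 1) : ℝ) ≤
      (gaussDigit s + 1) * (gaussDigit (gaussMap s) + 1) * negQ x (N + 1) := by
  have hinv := inv_eq_gaussDigit_add hs.1
  obtain ⟨j, hj⟩ : ∃ j, gaussDigit s = j + 1 :=
    ⟨_, (Nat.sub_add_cancel (one_le_gaussDigit hs)).symm⟩
  obtain ⟨h1, h2, h3⟩ := negCF_run hs hs' hN (j := j) hj.ge
  obtain ⟨hGi, hG0, hG1⟩ := gaussMap_mem hs'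
  obtain ⟨-, hH0, hH1⟩ := gaussMap_mem hGi
  have hinv2 := inv_eq_gaussDigit_add hG0
  rw [hj] at hinv ⊢
  generalize gaussDigit (gaussMap s) = b at *
  obtain ⟨hd, hz⟩ := negCF_step (x := x) (n := N + j) (d := b + 2)
      (w := 1 - gaussMap (gaussMap s)) (by
        have e : s⁻¹ - j = 1 + gaussMap s := by rw [hinv]; push_cast; ring
        have e2 : 1 - (1 + gaussMap s)⁻¹ = gaussMap s / (1 + gaussMap s) := by
          field_simp; ring
        rw [h1, e, e2, one_div_div, add_div, div_self hG0.ne', one_div, hinv2]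
        push_cast; ring) ⟨by linarith, by linarith⟩
  refine ⟨hz, ?_⟩
  have hQ : negQ x (N + (j + 1) + 1) = (b + 2) * negQ x (N + j + 1) - negQ x (N + j) := by
    rw [show N + (j + 1) + 1 = N + j + 2 by ring, negQ, hd]; push_cast; rfl
  obtain ⟨i0, i1⟩ := negQ_increment hx hx' N
  have hQ' : negQ x (N + (j + 1) + 1) ≤ (((j + 1 : ℕ) : ℤ) + 1) * (b + 1) * negQ x (N + 1) := by
    have e : negQ x (N + (j + 1) + 1) =
        (b + 1) * (negQ x (N + 1) + j * (negQ x (N + 1) - negQ x N)) +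
          (negQ x (N + 1) - negQ x N) := by rw [hQ, ← h3, ← h2]; ring
    rw [e]
    push_cast
    have hb : (0 : ℤ) ≤ b := by positivity
    have hj0 : (0 : ℤ) ≤ j := by positivity
    have m1 : 0 ≤ ((b : ℤ) + 1) * (j * negQ x N) := by positivity
    have m2 : 0 ≤ (b : ℤ) * negQ x (N + 1) := mul_nonneg hb (by linarith)
    linarith
  exact_mod_cast hQ'

lemma exists_negCF_time {x : ℝ} (hx : Irrational x) (hx' : x ∈ Set.Ioo (0 : ℝ) 1)
    (k : ℕ) : ∃ N, negT^[N] (1 - x) = 1 - gaussMap^[2 * k] x ∧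
    (negQ x (N + 1) : ℝ) ≤
      ∏ i ∈ Finset.range (2 * k), ((gaussDigit (gaussMap^[i] x) : ℝ) + 1) := by
  induction k with
  | zero => exact ⟨0, by simp, by simp [negQ]⟩
  | succ k ih =>
    obtain ⟨N, hN, hQ⟩ := ih
    obtain ⟨hs', hs⟩ := gaussMap_iterate_mem hx hx' (2 * k)
    obtain ⟨h1, h2⟩ := negCF_gauss_step hx hx' hs hs' hN
    refine ⟨_, ?_, h2.trans ?_⟩
    · rw [h1, show 2 * (k + 1) = 2 * k + 1 + 1 by ring, Function.iterate_succ_apply',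
        Function.iterate_succ_apply']
    · rw [show 2 * (k + 1) = 2 * k + 1 + 1 by ring, Finset.prod_range_succ,
        Finset.prod_range_succ, Function.iterate_succ_apply', mul_assoc _ (_ + 1) (_ + 1), mul_comm]
      exact mul_le_mul_of_nonneg_right hQ (by positivity)

/-- A large digit `a` at position `2 k` yields an index `n ≥ a - 2` at which the negative
continued fraction denominator is still small. -/
lemma exists_negCF_index {x : ℝ} (hx : Irrational x) (hx' : x ∈ Set.Ioo (0 : ℝ) 1)
    (k : ℕ) (ha : 2 ≤ gaussDigit (gaussMap^[2 * k] x)) :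
    ∃ n, gaussDigit (gaussMap^[2 * k] x) ≤ n + 2 ∧ 1 / 2 ≤ negT^[n] (1 - x) ∧
      (negQ x (n + 1) : ℝ) ≤ gaussDigit (gaussMap^[2 * k] x) *
        ∏ i ∈ Finset.range (2 * k), ((gaussDigit (gaussMap^[i] x) : ℝ) + 1) := by
  obtain ⟨N, hN, hQ⟩ := exists_negCF_time hx hx' k
  obtain ⟨hs', hs⟩ := gaussMap_iterate_mem hx hx' (2 * k)
  set s := gaussMap^[2 * k] x
  obtain ⟨j, hj⟩ : ∃ j, gaussDigit s = j + 2 := ⟨_, (Nat.sub_add_cancel ha).symm⟩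
  obtain ⟨h1, -, h3⟩ := negCF_run hs hs' hN (j := j) (by omega)
  have hinv := inv_eq_gaussDigit_add hs.1
  have hG := (gaussMap_mem hs').2.1
  rw [hj] at hinv ⊢
  refine ⟨N + j, by omega, ?_, ?_⟩
  · have : 2 ≤ s⁻¹ - j := by rw [hinv]; push_cast; linarith
    have := inv_anti₀ (by norm_num) this
    rw [h1]
    linarith
  · obtain ⟨i0, i1⟩ := negQ_increment hx hx' N
    have i0' : (0 : ℝ) ≤ negQ x N := by exact_mod_cast i0
    have i1' : (1 : ℝ) ≤ negQ x (N + 1) - negQ x N := by exact_mod_cast i1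
    have h3' : (negQ x (N + j + 1) : ℝ) =
        negQ x (N + 1) + j * (negQ x (N + 1) - negQ x N) := by exact_mod_cast h3
    refine le_trans ?_ (mul_le_mul_of_nonneg_left hQ (by positivity))
    rw [h3']
    push_cast
    have : (0 : ℝ) ≤ j * negQ x N := by positivity
    linarith

lemma frequently_log_div_mul_le {x L : ℝ} (hx : Irrational x) (hx' : x ∈ Set.Ioo (0 : ℝ) 1)
    (hL : 0 < L)
    (hprod : ∀ᶠ k in atTop,
      ∏ i ∈ Finset.range k, ((gaussDigit (gaussMap^[i] x) : ℝ) + 1) ≤ exp (L * k))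
    (hdigit : ∀ C k₀ : ℕ,
      ∃ k, k₀ ≤ k ∧ (C : ℝ) * (k * (1 + log k)) + 2 ≤ gaussDigit (gaussMap^[2 * k] x))
    {ε : ℝ} (hε : 0 < ε) :
    ∃ᶠ n : ℕ in atTop, log n / n * (2 * log (negQ x (n + 1)) + log 2) ≤ ε ∧
      1 / 2 ≤ negT^[n] (1 - x) := by
  obtain ⟨C, hC⟩ := exists_nat_ge (max 1 (24 * L / ε))
  have hC1 : (1 : ℝ) ≤ C := (le_max_left _ _).trans hC
  have hCL : 24 * L ≤ C * ε := (div_le_iff₀ hε).1 ((le_max_right _ _).trans hC)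
  have hlim : ∀ᶠ n : ℕ in atTop, log n ^ 2 ≤ ε / 10 * n := by
    have h := (Real.isLittleO_pow_log_id_atTop (n := 2)).def (show (0 : ℝ) < ε / 10 by positivity)
    filter_upwards [tendsto_natCast_atTop_atTop.eventually h] with n hn
    simpa using hn
  obtain ⟨n₁, hn₁⟩ := eventually_atTop.1 hlim
  obtain ⟨k₁, hk₁⟩ := eventually_atTop.1 hprod
  rw [frequently_atTop]
  intro n₀
  obtain ⟨k, hk, ha⟩ := hdigit C (n₀ + n₁ + k₁ + C + 3)
  have hk3 : (3 : ℝ) ≤ k := by exact_mod_cast (by omega : 3 ≤ k)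
  have hCk : (C : ℝ) ≤ k := by exact_mod_cast (by omega : C ≤ k)
  have hlogk : 0 ≤ log k := Real.log_nonneg (by linarith)
  set b : ℝ := C * (k * (1 + log k)) with hb
  have hkb : (k : ℝ) ≤ b := by
    have : (k : ℝ) ≤ k * (1 + log k) := by nlinarith
    nlinarith
  obtain ⟨n, han, hz, hQ⟩ := exists_negCF_index hx hx' k (by
    exact_mod_cast (by linarith : (2 : ℝ) ≤ gaussDigit (gaussMap^[2 * k] x)))
  have han' : (gaussDigit (gaussMap^[2 * k] x) : ℝ) ≤ n + 2 := by exact_mod_cast han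
  have hbn : b ≤ n := by linarith
  have hkn : k ≤ n := by exact_mod_cast hkb.trans hbn
  refine ⟨n, by omega, ?_, hz⟩
  have hn3 : (3 : ℝ) ≤ n := by linarith
  have he : exp 1 ≤ 3 := by linarith [Real.exp_one_lt_d9]
  have hlogn : 1 ≤ log n := by
    rw [Real.le_log_iff_exp_le (by linarith)]; linarith
  have hQpos : (0 : ℝ) < negQ x (n + 1) := by
    obtain ⟨h0, h1⟩ := negQ_increment hx hx' n
    exact_mod_cast (by linarith : (0 : ℤ) < negQ x (n + 1))
  have hlogQ : log (negQ x (n + 1)) ≤ 2 * log n + 2 * L * k := by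
    have h1 : (negQ x (n + 1) : ℝ) ≤ n ^ 2 * exp (2 * L * k) := by
      refine hQ.trans (mul_le_mul (by nlinarith) ?_ (Finset.prod_nonneg fun i _ => by positivity)
        (by positivity))
      refine (hk₁ (2 * k) (by omega)).trans (le_of_eq ?_)
      congr 1; push_cast; ring
    refine (Real.log_le_log hQpos h1).trans (le_of_eq ?_)
    rw [Real.log_mul (by positivity) (exp_pos _).ne', Real.log_pow, Real.log_exp]
    push_cast; ring
  have hlogb : log b ≤ 3 * (1 + log k) := by
    have h1 : log C ≤ log k := Real.log_le_log (by linarith) hCk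
    have h2 : log (1 + log k) ≤ log k :=
      Real.log_le_log (by positivity)
        (by linarith [Real.log_le_sub_one_of_pos (by linarith : (0 : ℝ) < k)])
    rw [hb, Real.log_mul (by positivity) (by positivity), Real.log_mul (by positivity)
      (by positivity)]
    linarith
  have hdiv : log n / n ≤ 3 / (C * k) := by
    calc log n / n ≤ log b / b :=
          Real.log_div_self_antitoneOn (Set.mem_Ici.2 (by linarith))
            (Set.mem_Ici.2 (by linarith)) hbn
      _ ≤ 3 * (1 + log k) / b := by gcongr
      _ = 3 / (C * k) := by rw [hb]; field_simp
  have hsq : log n / n * (5 * log n) ≤ ε / 2 := by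
    rw [div_mul_eq_mul_div, div_le_iff₀ (by linarith)]
    nlinarith [hn₁ n (by omega)]
  have hlin : log n / n * (4 * L * k) ≤ ε / 2 := by
    refine (mul_le_mul_of_nonneg_right hdiv (by positivity)).trans ?_
    rw [div_mul_eq_mul_div, div_le_iff₀ (by positivity)]
    nlinarith [mul_le_mul_of_nonneg_right hCL (by linarith : (0 : ℝ) ≤ k)]
  calc log n / n * (2 * log (negQ x (n + 1)) + log 2)
      ≤ log n / n * (5 * log n + 4 * L * k) := by
        refine mul_le_mul_of_nonneg_left ?_ (by positivity)
        linarith [Real.log_two_lt_d9]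
    _ ≤ ε := by rw [mul_add]; linarith

lemma liminf_eq_zero_of_frequently_le {u : ℕ → ℝ} (h0 : ∀ n, 0 ≤ u n)
    (h : ∀ ε > 0, ∃ᶠ n in atTop, u n ≤ ε) : liminf u atTop = 0 := by
  have hb : IsBoundedUnder (· ≥ ·) atTop u := isBoundedUnder_of ⟨0, h0⟩
  refine le_antisymm (le_of_forall_pos_le_add fun ε hε => ?_) ?_
  · rw [zero_add]
    exact liminf_le_of_frequently_le (h ε hε) hb
  · exact le_liminf_of_le (IsCoboundedUnder.of_frequently_le (h 1 one_pos)) (.of_forall h0)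

lemma limsup_eq_zero_of_frequently_ge {u : ℕ → ℝ} (h0 : ∀ n, u n ≤ 0)
    (h : ∀ ε > 0, ∃ᶠ n in atTop, -ε ≤ u n) : limsup u atTop = 0 := by
  have hb : IsBoundedUnder (· ≤ ·) atTop u := isBoundedUnder_of ⟨0, h0⟩
  refine le_antisymm ?_ (le_of_forall_pos_le_add fun ε hε => ?_)
  · exact limsup_le_of_le (IsCoboundedUnder.of_frequently_ge (h 1 one_pos)) (.of_forall h0)
  · linarith [le_limsup_of_frequently_le (h ε hε) hb]

/-- For a.e. irrational `x ∈ (0,1)`: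
`liminf (log n / n) log Qₙ = 0` and `limsup (log n / n) log |x - Pₙ/Qₙ| = 0`. -/
theorem negCF_liminf_zero_limsup_zero :
    ∀ᵐ x ∂(volume.restrict (Set.Ioo (0 : ℝ) 1)), Irrational x →
      Filter.liminf (fun n : ℕ => Real.log n / n * Real.log (negQ x (n + 1))) atTop = 0 ∧
      Filter.limsup (fun n : ℕ =>
          Real.log n / n * Real.log |x - (negP x (n + 1) : ℝ) / (negQ x (n + 1) : ℝ)|)
        atTop = 0 := by
  obtain ⟨L, hL, hprod⟩ := ae_exists_prod_digit_le
  filter_upwards [hprod, ae_frequently_digit_ge, ae_restrict_mem measurableSet_Ioo]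
    with x hprod hdigit hx' hx
  have hfreq := fun ε (hε : 0 < ε) => frequently_log_div_mul_le hx hx' hL hprod hdigit hε
  have hcoef : ∀ n : ℕ, 0 ≤ log n / n := fun n =>
    div_nonneg (Real.log_natCast_nonneg n) n.cast_nonneg
  have hlog2 : 0 ≤ log 2 := Real.log_nonneg one_le_two
  refine ⟨liminf_eq_zero_of_frequently_le
    (fun n => mul_nonneg (hcoef n) (log_negQ_nonneg hx hx' n)) fun ε hε => ?_,
    limsup_eq_zero_of_frequently_ge
    (fun n => mul_nonpos_of_nonneg_of_nonpos (hcoef n) (log_abs_sub_negCF_nonpos hx hx' n))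
    fun ε hε => ?_⟩
  · refine (hfreq ε hε).mono fun n hn => le_trans ?_ hn.1
    exact mul_le_mul_of_nonneg_left (by linarith [log_negQ_nonneg hx hx' n]) (hcoef n)
  · refine (hfreq ε hε).mono fun n hn => ?_
    have := mul_le_mul_of_nonneg_left (neg_le_log_abs_sub_negCF hx hx' hn.2) (hcoef n)
    linarith [hn.1]
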